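/- Let D be an open set in ℝ^m with finite Lebesgue measure, and let s ≥ 0 and t ≥ 0. Then F_D(s+t) ≤ F_D(s) + F_D(t). -/

import Mathlib

open MeasureTheory Metric Set

noncomputable def heatKernel (m : ℕ) (t : ℝ) (x y : EuclideanSpace ℝ (Fin m)) : ℝ :=
  (4 * Real.pi * t) ^ (-(m : ℝ) / 2) * Real.exp (-(dist x y) ^ 2 / (4 * t))

noncomputable def heatContent (m : ℕ) (D : Set (EuclideanSpace ℝ (Fin m))) (t : ℝ) : ℝ :=
  ∫ x in D, ∫ y in D, heatKernel m t x y

/-- The heat loss of `D` in `ℝ^m` at time `t`, with the convention `F_D(0) = 0`. -/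
noncomputable def heatLoss (m : ℕ) (D : Set (EuclideanSpace ℝ (Fin m))) (t : ℝ) : ℝ :=
  if t = 0 then 0 else (volume D).toReal - heatContent m D t

theorem integrable_exp_neg_mul_norm_sq {m : ℕ} {b : ℝ} (hb : 0 < b) :
    Integrable fun v : EuclideanSpace ℝ (Fin m) => Real.exp (-b * ‖v‖ ^ 2) := by
  by_contra h
  have h1 := GaussianFourier.integral_rexp_neg_mul_sq_norm
    (V := EuclideanSpace ℝ (Fin m)) hb
  rw [integral_undef h] at h1
  have : 0 < (Real.pi / b) ^ (Module.finrank ℝ (EuclideanSpace ℝ (Fin m)) / 2 : ℝ) := by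
    positivity
  linarith

theorem heatKernel_nonneg {m : ℕ} {t : ℝ} (ht : 0 < t) (x y : EuclideanSpace ℝ (Fin m)) :
    0 ≤ heatKernel m t x y := by
  unfold heatKernel
  positivity

theorem heatKernel_comm {m : ℕ} (t : ℝ) (x y : EuclideanSpace ℝ (Fin m)) :
    heatKernel m t x y = heatKernel m t y x := by
  simp only [heatKernel, dist_comm]

theorem continuous_heatKernel (m : ℕ) (t : ℝ) :
    Continuous fun p : EuclideanSpace ℝ (Fin m) × EuclideanSpace ℝ (Fin m) =>
      heatKernel m t p.1 p.2 := by
  unfold heatKernel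
  fun_prop

theorem heatKernel_eq {m : ℕ} (t : ℝ) (x y : EuclideanSpace ℝ (Fin m)) :
    heatKernel m t x y =
      (4 * Real.pi * t) ^ (-(m : ℝ) / 2) * Real.exp (-(1 / (4 * t)) * ‖y - x‖ ^ 2) := by
  rw [heatKernel, dist_comm, dist_eq_norm]
  ring_nf

theorem integrable_heatKernel {m : ℕ} {t : ℝ} (ht : 0 < t) (x : EuclideanSpace ℝ (Fin m)) :
    Integrable (heatKernel m t x) := by
  have := ((integrable_exp_neg_mul_norm_sq (m := m) (b := 1 / (4 * t))
    (by positivity)).comp_sub_right x).const_mul ((4 * Real.pi * t) ^ (-(m : ℝ) / 2))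
  exact this.congr (.of_forall fun y => (heatKernel_eq t x y).symm)

theorem integral_heatKernel {m : ℕ} {t : ℝ} (ht : 0 < t) (x : EuclideanSpace ℝ (Fin m)) :
    ∫ y, heatKernel m t x y = 1 := by
  simp_rw [heatKernel_eq]
  rw [integral_const_mul,
    integral_sub_right_eq_self (fun v => Real.exp (-(1 / (4 * t)) * ‖v‖ ^ 2)) x,
    GaussianFourier.integral_rexp_neg_mul_sq_norm (by positivity), finrank_euclideanSpace_fin,
    show Real.pi / (1 / (4 * t)) = 4 * Real.pi * t by field_simp,
    ← Real.rpow_add (by positivity)]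
  ring_nf
  simp

/-- Completing the square in the product of two heat kernels. -/
theorem heatKernel_mul_heatKernel {m : ℕ} {s t : ℝ} (hs : 0 < s) (ht : 0 < t)
    (x y z : EuclideanSpace ℝ (Fin m)) :
    heatKernel m s x z * heatKernel m t z y =
      heatKernel m (s + t) x y *
        heatKernel m (s * t / (s + t)) ((t / (s + t)) • x + (s / (s + t)) • y) z := by
  have hst : 0 < s + t := by positivity
  have hconst : (4 * Real.pi * s) ^ (-(m : ℝ) / 2) * (4 * Real.pi * t) ^ (-(m : ℝ) / 2) =
      (4 * Real.pi * (s + t)) ^ (-(m : ℝ) / 2) *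
        (4 * Real.pi * (s * t / (s + t))) ^ (-(m : ℝ) / 2) := by
    rw [← Real.mul_rpow (by positivity) (by positivity),
      ← Real.mul_rpow (by positivity) (by positivity)]
    congr 1
    field_simp
  have hexp : -(dist x z) ^ 2 / (4 * s) + -(dist z y) ^ 2 / (4 * t) =
      -(dist x y) ^ 2 / (4 * (s + t)) +
        -(dist ((t / (s + t)) • x + (s / (s + t)) • y) z) ^ 2 / (4 * (s * t / (s + t))) := by
    have hmid : (t / (s + t)) • x + (s / (s + t)) • y - z =
        (t / (s + t)) • (x - z) - (s / (s + t)) • (z - y) := by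
      have hz : z = (t / (s + t)) • z + (s / (s + t)) • z := by
        rw [← add_smul, ← add_div, add_comm t s, div_self hst.ne', one_smul]
      nth_rw 1 [hz]
      module
    have hxy : x - y = (x - z) + (z - y) := by abel
    simp only [dist_eq_norm]
    rw [hmid, hxy]
    generalize x - z = a
    generalize z - y = b
    rw [norm_sub_sq_real, norm_add_sq_real]
    simp only [norm_smul, real_inner_smul_left, real_inner_smul_right, Real.norm_eq_abs,
      mul_pow, sq_abs]
    field_simp
    ring
  unfold heatKernel
  rw [mul_mul_mul_comm, ← Real.exp_add, hexp, hconst, Real.exp_add, mul_mul_mul_comm]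

theorem lintegral_heatKernel {m : ℕ} {t : ℝ} (ht : 0 < t) (x : EuclideanSpace ℝ (Fin m)) :
    ∫⁻ y, ENNReal.ofReal (heatKernel m t x y) = 1 := by
  rw [← ofReal_integral_eq_lintegral_ofReal (integrable_heatKernel ht x)
    (.of_forall (heatKernel_nonneg ht x)), integral_heatKernel ht, ENNReal.ofReal_one]

theorem setLIntegral_heatKernel_le_one {m : ℕ} {t : ℝ} (ht : 0 < t)
    (D : Set (EuclideanSpace ℝ (Fin m))) (x : EuclideanSpace ℝ (Fin m)) :
    ∫⁻ y in D, ENNReal.ofReal (heatKernel m t x y) ≤ 1 :=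
  (setLIntegral_le_lintegral _ _).trans (lintegral_heatKernel ht x).le

/-- The Chapman–Kolmogorov identity for the heat kernel. -/
theorem lintegral_heatKernel_mul_heatKernel {m : ℕ} {s t : ℝ} (hs : 0 < s) (ht : 0 < t)
    (x y : EuclideanSpace ℝ (Fin m)) :
    ∫⁻ z, ENNReal.ofReal (heatKernel m s x z) * ENNReal.ofReal (heatKernel m t z y) =
      ENNReal.ofReal (heatKernel m (s + t) x y) := by
  simp_rw [← ENNReal.ofReal_mul (heatKernel_nonneg hs _ _), heatKernel_mul_heatKernel hs ht,
    ENNReal.ofReal_mul (heatKernel_nonneg (add_pos hs ht) _ _)]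
  rw [lintegral_const_mul' _ _ ENNReal.ofReal_ne_top, lintegral_heatKernel (by positivity),
    mul_one]

theorem measurable_ofReal_heatKernel (m : ℕ) (t : ℝ) :
    Measurable fun p : EuclideanSpace ℝ (Fin m) × EuclideanSpace ℝ (Fin m) =>
      ENNReal.ofReal (heatKernel m t p.1 p.2) :=
  (continuous_heatKernel m t).measurable.ennreal_ofReal

theorem measurable_setLIntegral_heatKernel (m : ℕ) (t : ℝ)
    (D : Set (EuclideanSpace ℝ (Fin m))) :
    Measurable fun x => ∫⁻ y in D, ENNReal.ofReal (heatKernel m t x y) :=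
  (measurable_ofReal_heatKernel m t).lintegral_prod_right'

theorem lintegral_heatKernel_le_volume {m : ℕ} {t : ℝ} (ht : 0 < t)
    (D : Set (EuclideanSpace ℝ (Fin m))) :
    ∫⁻ x in D, ∫⁻ y in D, ENNReal.ofReal (heatKernel m t x y) ≤ volume D :=
  (lintegral_mono fun x => setLIntegral_heatKernel_le_one ht D x).trans_eq (by simp)

theorem heatContent_eq_toReal_lintegral {m : ℕ} {t : ℝ} (ht : 0 < t)
    (D : Set (EuclideanSpace ℝ (Fin m))) :
    heatContent m D t =
      (∫⁻ x in D, ∫⁻ y in D, ENNReal.ofReal (heatKernel m t x y)).toReal := by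
  rw [← integral_toReal (measurable_setLIntegral_heatKernel m t D).aemeasurable
    (.of_forall fun x => (setLIntegral_heatKernel_le_one ht D x).trans_lt ENNReal.one_lt_top)]
  refine integral_congr_ae (.of_forall fun x => ?_)
  exact integral_eq_lintegral_of_nonneg_ae (.of_forall (heatKernel_nonneg ht x))
    (integrable_heatKernel ht x).aestronglyMeasurable.restrict

/-- The heat content at time `s + t`, as a pairing of the heat flows at times `s` and `t`. -/
theorem lintegral_heatKernel_add {m : ℕ} {s t : ℝ} (hs : 0 < s) (ht : 0 < t)
    (D : Set (EuclideanSpace ℝ (Fin m))) :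
    ∫⁻ x in D, ∫⁻ y in D, ENNReal.ofReal (heatKernel m (s + t) x y) =
      ∫⁻ z, (∫⁻ x in D, ENNReal.ofReal (heatKernel m s z x)) *
        ∫⁻ y in D, ENNReal.ofReal (heatKernel m t z y) := by
  have hk := measurable_ofReal_heatKernel m
  have hu := measurable_setLIntegral_heatKernel m t D
  calc
    _ = ∫⁻ x in D, ∫⁻ y in D, ∫⁻ z,
          ENNReal.ofReal (heatKernel m s x z) * ENNReal.ofReal (heatKernel m t z y) := by
      simp_rw [lintegral_heatKernel_mul_heatKernel hs ht]
    _ = ∫⁻ x in D, ∫⁻ z, ENNReal.ofReal (heatKernel m s x z) *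
          ∫⁻ y in D, ENNReal.ofReal (heatKernel m t z y) := by
      refine lintegral_congr fun x => ?_
      rw [lintegral_lintegral_swap]
      · exact lintegral_congr fun z => lintegral_const_mul' _ _ ENNReal.ofReal_ne_top
      · exact (((hk s).comp (measurable_const.prodMk measurable_snd)).mul
          ((hk t).comp (measurable_snd.prodMk measurable_fst))).aemeasurable
    _ = ∫⁻ z, ∫⁻ x in D, ENNReal.ofReal (heatKernel m s x z) *
          ∫⁻ y in D, ENNReal.ofReal (heatKernel m t z y) :=
      lintegral_lintegral_swap ((hk s).mul (hu.comp measurable_snd)).aemeasurable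
    _ = _ := by
      refine lintegral_congr fun z => ?_
      rw [lintegral_mul_const' _ _
        ((setLIntegral_heatKernel_le_one ht D z).trans_lt ENNReal.one_lt_top).ne]
      simp_rw [heatKernel_comm s _ z]

theorem ENNReal.add_le_one_add_mul {a b : ENNReal} (ha : a ≤ 1) (hb : b ≤ 1) :
    a + b ≤ 1 + a * b := by
  lift a to NNReal using (ha.trans_lt ENNReal.one_lt_top).ne
  lift b to NNReal using (hb.trans_lt ENNReal.one_lt_top).ne
  norm_cast at *
  rw [← NNReal.coe_le_coe] at *
  push_cast at *
  nlinarith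

theorem lintegral_heatKernel_add_le {m : ℕ} {s t : ℝ} (hs : 0 < s) (ht : 0 < t)
    (D : Set (EuclideanSpace ℝ (Fin m))) :
    (∫⁻ x in D, ∫⁻ y in D, ENNReal.ofReal (heatKernel m s x y)) +
        ∫⁻ x in D, ∫⁻ y in D, ENNReal.ofReal (heatKernel m t x y) ≤
      volume D + ∫⁻ x in D, ∫⁻ y in D, ENNReal.ofReal (heatKernel m (s + t) x y) := by
  rw [lintegral_heatKernel_add hs ht,
    ← lintegral_add_left (measurable_setLIntegral_heatKernel m s D)]
  calc
    _ ≤ ∫⁻ z in D, (1 + (∫⁻ x in D, ENNReal.ofReal (heatKernel m s z x)) *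
          ∫⁻ y in D, ENNReal.ofReal (heatKernel m t z y)) :=
      lintegral_mono fun z => ENNReal.add_le_one_add_mul
        (setLIntegral_heatKernel_le_one hs D z) (setLIntegral_heatKernel_le_one ht D z)
    _ ≤ _ := by
      rw [lintegral_add_left measurable_const, setLIntegral_one]
      gcongr
      exact Measure.restrict_le_self

theorem heatLoss_subadditive (m : ℕ) (D : Set (EuclideanSpace ℝ (Fin m))) (hD : IsOpen D)
    (hvol : volume D < ⊤) (s t : ℝ) (hs : 0 ≤ s) (ht : 0 ≤ t) :
    heatLoss m D (s + t) ≤ heatLoss m D s + heatLoss m D t := by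
  rcases hs.eq_or_lt with rfl | hs
  · simp [heatLoss]
  rcases ht.eq_or_lt with rfl | ht
  · simp [heatLoss]
  have hfin {r : ℝ} (hr : 0 < r) := ((lintegral_heatKernel_le_volume hr D).trans_lt hvol).ne
  have key := ENNReal.toReal_mono
    (ENNReal.add_ne_top.2 ⟨hvol.ne, hfin (add_pos hs ht)⟩) (lintegral_heatKernel_add_le hs ht D)
  rw [ENNReal.toReal_add (hfin hs) (hfin ht),
    ENNReal.toReal_add hvol.ne (hfin (add_pos hs ht)), ← heatContent_eq_toReal_lintegral hs,
    ← heatContent_eq_toReal_lintegral ht, ← heatContent_eq_toReal_lintegral (add_pos hs ht)] at key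
  simp only [heatLoss, hs.ne', ht.ne', (add_pos hs ht).ne', if_false]
  linarith
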